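/- arXiv:1312.0687 — 2 statements merged into one kernel-verified Lean document; each statement's English description precedes it below -/
import Mathlib

section
/- Let k be a field of characteristic 5 and let s ∈ k satisfy s² = 2. Let x, y ∈ k satisfy y² = x³ − 1 and x ≠ 1, and set x′ = (x + 2)/(x − 1) and y′ = 2y/(x − 1)². Then x′ ≠ 1, y′² = x′³ − 1, and the functions u = (2x² + 3x + 1)/(x − 1) and v = 2·s·y·(x² + 3x + 3)/(x − 1)² are invariant under this substitution: (2x′² + 3x′ + 1)/(x′ − 1) = (2x² + 3x + 1)/(x − 1) and 2·s·y′·(x′² + 3x′ + 3)/(x′ − 1)² = 2·s·y·(x² + 3x + 3)/(x − 1)². -/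
/-!
Let `k` be a field of characteristic 5 and let `s ∈ k` satisfy `s² = 2`.  Let
`x, y ∈ k` satisfy `y² = x³ − 1` and `x ≠ 1`, and set `x′ = (x + 2)/(x − 1)` and
`y′ = 2y/(x − 1)²`.  Then `x′ ≠ 1`, `y′² = x′³ − 1`, and the functions
`u = (2x² + 3x + 1)/(x − 1)` and `v = 2·s·y·(x² + 3x + 3)/(x − 1)²` are invariant under
this substitution.
-/

theorem u_v_invariant_under_translation_by_two_torsion {k : Type*} [Field k] [CharP k 5]
    (s : k) (hs : s ^ 2 = 2) (x y : k) (hxy : y ^ 2 = x ^ 3 - 1) (hx : x ≠ 1) :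
    (x + 2) / (x - 1) ≠ 1 ∧
      (2 * y / (x - 1) ^ 2) ^ 2 = ((x + 2) / (x - 1)) ^ 3 - 1 ∧
      (2 * ((x + 2) / (x - 1)) ^ 2 + 3 * ((x + 2) / (x - 1)) + 1) /
          ((x + 2) / (x - 1) - 1) =
        (2 * x ^ 2 + 3 * x + 1) / (x - 1) ∧
      2 * s * (2 * y / (x - 1) ^ 2) *
            (((x + 2) / (x - 1)) ^ 2 + 3 * ((x + 2) / (x - 1)) + 3) /
          ((x + 2) / (x - 1) - 1) ^ 2 =
        2 * s * y * (x ^ 2 + 3 * x + 3) / (x - 1) ^ 2 := by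
  have h5 : (5 : k) = 0 := by exact_mod_cast CharP.cast_eq_zero k 5
  obtain ⟨d, rfl⟩ : ∃ d, x = d + 1 := ⟨x - 1, by ring⟩
  have hd : d ≠ 0 := fun h => hx (by rw [h, zero_add])
  obtain ⟨i, hi⟩ : ∃ i, i = d⁻¹ := ⟨_, rfl⟩
  have hdi : d * i = 1 := by rw [hi]; exact mul_inv_cancel₀ hd
  have e1 : d + 1 - 1 = d := by ring
  have e2 : (d + 1 + 2) / d = 1 + 3 * i := by
    rw [div_eq_mul_inv, ← hi]; linear_combination hdi
  have e3 : (1 + 3 * i - 1)⁻¹ = 2 * d := by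
    apply inv_eq_of_mul_eq_one_right
    linear_combination 6 * hdi + h5
  rw [e1, e2]
  refine ⟨?_, ?_, ?_, ?_⟩
  · intro h
    have h3 : 3 * i = 0 := by linear_combination h
    have : (1 : k) = 0 := by linear_combination 2 * d * h3 - 6 * hdi - h5
    exact one_ne_zero this
  · simp only [div_eq_mul_inv, ← inv_pow, ← hi]
    grind
  · simp only [div_eq_mul_inv, e3, ← hi]
    grind
  · simp only [div_eq_mul_inv, ← inv_pow, e3, ← hi]
    grind
end

section
/- The Fermat sextic curve x⁶ + y⁶ + z⁶ = 0 has exactly 126 points rational over the field F₂₅ with 25 elements; equivalently, the set of nonzero triples (x, y, z) ∈ F₂₅³ with x⁶ + y⁶ + z⁶ = 0 has exactly 126 · 24 = 3024 elements. -/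
/-!
The Fermat sextic curve `x⁶ + y⁶ + z⁶ = 0` has exactly 126 points rational over the
field `F₂₅` with 25 elements; equivalently, the set of nonzero triples
`(x, y, z) ∈ F₂₅³` with `x⁶ + y⁶ + z⁶ = 0` has exactly `126 · 24 = 3024` elements.
-/

instance : Fact (Nat.Prime 5) := ⟨by norm_num⟩

/-- The finite field with 25 elements. -/
abbrev F25 : Type := GaloisField 5 2

/-- Coordinates with respect to the basis `1, √2`. -/
abbrev V25 : Type := ZMod 5 × ZMod 5

/-- The norm form `a² - 2 b²`. -/
def nrm (v : V25) : ZMod 5 := v.1 ^ 2 - 2 * v.2 ^ 2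

/-- The number of vectors of a given norm. -/
def rep (w : ZMod 5) : ℕ := if w = 0 then 1 else 6

theorem sum_third : ∀ w : ZMod 5, (∑ v : V25, if w + nrm v = 0 then 1 else 0) = rep w := by
  decide +kernel

theorem sum_second : ∀ w : ZMod 5,
    (∑ v : V25, rep (w + nrm v)) = if w = 0 then 145 else 120 := by
  decide +kernel

theorem sum_first : (∑ v : V25, if nrm v = 0 then 145 else 120) = 3025 := by
  decide +kernel

theorem card_all : (Finset.univ.filter
    (fun q : V25 × V25 × V25 => nrm q.1 + nrm q.2.1 + nrm q.2.2 = 0)).card = 3025 := by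
  rw [Finset.card_filter, Fintype.sum_prod_type]
  simp_rw [Fintype.sum_prod_type (f := fun x : V25 × V25 => _), sum_third, sum_second, sum_first]

theorem card_nonzero : Nat.card {q : V25 × V25 × V25 //
    q ≠ 0 ∧ nrm q.1 + nrm q.2.1 + nrm q.2.2 = 0} = 126 * 24 := by
  rw [Nat.card_eq_fintype_card, Fintype.card_subtype]
  have h : (Finset.univ.filter (fun q : V25 × V25 × V25 =>
      q ≠ 0 ∧ nrm q.1 + nrm q.2.1 + nrm q.2.2 = 0)) =
      (Finset.univ.filter
        (fun q : V25 × V25 × V25 => nrm q.1 + nrm q.2.1 + nrm q.2.2 = 0)).erase 0 := by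
    ext q
    simp
  rw [h, Finset.card_erase_of_mem (Finset.mem_filter.mpr ⟨Finset.mem_univ _, by simp [nrm]⟩), card_all]

theorem exists_sqrt_two : ∃ s : F25, s ^ 2 = 2 := by
  have : Fintype F25 := Fintype.ofFinite _
  have hc : Fintype.card F25 = 25 := by
    rw [← Nat.card_eq_fintype_card, GaloisField.card 5 2 (by norm_num)]; norm_num
  have h5 : (5 : F25) = 0 := by exact_mod_cast CharP.cast_eq_zero F25 5
  have h2 : (2 : F25) ≠ 0 := by
    intro h
    have : (1 : F25) = 0 := by linear_combination h5 - 2 * h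
    exact one_ne_zero this
  have hr : ringChar F25 ≠ 2 := by
    rw [ringChar.eq F25 5]; norm_num
  have hs : IsSquare (2 : F25) := by
    rw [FiniteField.isSquare_iff hr h2, hc]
    norm_num
    linear_combination 819 * h5
  obtain ⟨s, hs⟩ := hs
  exact ⟨s, by rw [hs, sq]⟩

/-- The linear map `(a, b) ↦ a + b s`. -/
noncomputable def coord (s : F25) (v : V25) : F25 :=
  algebraMap (ZMod 5) F25 v.1 + algebraMap (ZMod 5) F25 v.2 * s

theorem coord_pow (s : F25) (hs : s ^ 2 = 2) (v : V25) :
    coord s v ^ 6 = algebraMap (ZMod 5) F25 (nrm v) := by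
  have h5 : (5 : F25) = 0 := by exact_mod_cast CharP.cast_eq_zero F25 5
  have hf : coord s v ^ 5 =
      algebraMap (ZMod 5) F25 v.1 - algebraMap (ZMod 5) F25 v.2 * s := by
    have h1 : s ^ 5 = - s := by
      linear_combination (s ^ 3 + 2 * s) * hs + s * h5
    rw [coord, add_pow_char, mul_pow, ← map_pow, ← map_pow, ZMod.pow_card, ZMod.pow_card, h1]
    ring
  rw [pow_succ, hf, coord, nrm]
  simp only [map_sub, map_mul, map_pow, map_ofNat]
  linear_combination - (algebraMap (ZMod 5) F25 v.2) ^ 2 * hs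

theorem nrm_zero : ∀ v : V25, nrm v = 0 → v = 0 := by decide +kernel

theorem coord_bij (s : F25) (hs : s ^ 2 = 2) : Function.Bijective (coord s) := by
  have : Fintype F25 := Fintype.ofFinite _
  have hc : Fintype.card F25 = 25 := by
    rw [← Nat.card_eq_fintype_card, GaloisField.card 5 2 (by norm_num)]; norm_num
  rw [Fintype.bijective_iff_injective_and_card]
  refine ⟨fun v w h => ?_, by rw [hc]; simp [ZMod.card]⟩
  have h0 : coord s (v - w) = 0 := by
    simp only [coord, Prod.fst_sub, Prod.snd_sub, map_sub] at h ⊢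
    linear_combination h
  have h1 := coord_pow s hs (v - w)
  rw [h0, zero_pow (by norm_num), eq_comm, map_eq_zero] at h1
  exact sub_eq_zero.mp (nrm_zero _ h1)

theorem card_F25_points_of_fermat_sextic :
    Nat.card {p : F25 × F25 × F25 //
        p ≠ 0 ∧ p.1 ^ 6 + p.2.1 ^ 6 + p.2.2 ^ 6 = 0} = 126 * 24 := by
  obtain ⟨s, hs⟩ := exists_sqrt_two
  rw [← card_nonzero]
  let e : V25 ≃ F25 := Equiv.ofBijective (coord s) (coord_bij s hs)
  have he : ∀ v, e v = coord s v := fun v => rfl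
  have he0 : e 0 = 0 := by simp [he, coord]
  refine (Nat.card_congr (Equiv.subtypeEquiv (e.prodCongr (e.prodCongr e)) ?_)).symm
  rintro ⟨a, b, c⟩
  have hz : ∀ v, e v = 0 ↔ v = 0 := fun v => by rw [← he0, e.apply_eq_iff_eq]
  refine and_congr (not_congr ?_) ?_
  · simp [Prod.ext_iff (y := (0 : F25 × F25 × F25)), Prod.mk_eq_zero, hz]
  · simp only [Equiv.prodCongr_apply, Prod.map_apply, he, coord_pow s hs]
    rw [← map_add, ← map_add, map_eq_zero]
end
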